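/- Let W ∈ ∂θ(P) with P ≠ 0 and Q = P + W with SVD as in the context. Then H ∈ C_{θ*}(W,P) and φ*_{(W,H)}(P) = 0 hold simultaneously if and only if: H̃_{αα} is symmetric with trace(H̃_{αα}) = 0, H̃_{α₁α₁} is negative semidefinite, H̃_{α₃α₃} is positive semidefinite, and all blocks of H̃ outside the αα block vanish (i.e., H̃_{αβ} = 0, H̃_{αc} = 0, H̃_{βα} = 0, H̃_{ββ} = 0, H̃_{βc} = 0). -/

import Mathlib

open Matrix Filter Set RealInnerProductSpace

noncomputable section

/-- Trace inner product on real matrices: `⟨A,B⟩ = trace (Aᵀ B)`. -/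
def minner {ι κ : Type*} [Fintype ι] [Fintype κ] (A B : Matrix ι κ ℝ) : ℝ :=
  (Aᵀ * B).trace

/-- Frobenius norm. -/
def fnorm {ι κ : Type*} [Fintype ι] [Fintype κ] (A : Matrix ι κ ℝ) : ℝ :=
  Real.sqrt (minner A A)

/-- Spectral norm (largest singular value), as the ℓ²-operator norm. -/
def specNorm {ι κ : Type*} [Fintype ι] [Fintype κ] (A : Matrix ι κ ℝ) : ℝ :=
  sSup {r : ℝ | ∃ x : κ → ℝ, ∑ j, x j ^ 2 = 1 ∧
    r = Real.sqrt (∑ i, (∑ j, A i j * x j) ^ 2)}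

/-- Convex subdifferential with respect to the trace inner product. -/
def subdiff {ι κ : Type*} [Fintype ι] [Fintype κ] (f : Matrix ι κ ℝ → ℝ)
    (X : Matrix ι κ ℝ) : Set (Matrix ι κ ℝ) :=
  {G | ∀ Y, f X + minner G (Y - X) ≤ f Y}

/-- One-sided directional derivative. -/
def dirDeriv {ι κ : Type*} [Fintype ι] [Fintype κ] (f : Matrix ι κ ℝ → ℝ)
    (X D : Matrix ι κ ℝ) : ℝ :=
  limUnder (nhdsWithin (0 : ℝ) (Set.Ioi 0)) fun t => (f (X + t • D) - f X) / t

/-- Critical cone of the spectral norm θ at `P` for `W`. -/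
def critTheta {ι κ : Type*} [Fintype ι] [Fintype κ] (P W : Matrix ι κ ℝ) :
    Set (Matrix ι κ ℝ) :=
  {D | dirDeriv specNorm P D = minner D W}

/-- Conjugate θ* of the spectral norm, as an extended-real-valued function
(it is the indicator of the nuclear norm unit ball). -/
def thetaStar {ι κ : Type*} [Fintype ι] [Fintype κ] (W : Matrix ι κ ℝ) : EReal :=
  ⨆ X : Matrix ι κ ℝ, ((minner W X - specNorm X : ℝ) : EReal)

/-- Lower directional epiderivative of an extended-real-valued function. -/
def epiDeriv {ι κ : Type*} [Fintype ι] [Fintype κ] (g : Matrix ι κ ℝ → EReal)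
    (X D : Matrix ι κ ℝ) : EReal :=
  liminf (fun p : ℝ × Matrix ι κ ℝ =>
      (((p.1)⁻¹ : ℝ) : EReal) * (g (X + p.1 • p.2) - g X))
    ((nhdsWithin (0 : ℝ) (Set.Ioi 0)) ×ˢ nhds D)

/-- Critical cone of θ* at `W` for `P`. -/
def critThetaStar {ι κ : Type*} [Fintype ι] [Fintype κ] (W P : Matrix ι κ ℝ) :
    Set (Matrix ι κ ℝ) :=
  {D | epiDeriv thetaStar W D = ((minner D P : ℝ) : EReal)}

/-- Second-order directional derivative. -/
def dirDeriv2 {ι κ : Type*} [Fintype ι] [Fintype κ] (f : Matrix ι κ ℝ → ℝ)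
    (X D W' : Matrix ι κ ℝ) : ℝ :=
  limUnder (nhdsWithin (0 : ℝ) (Set.Ioi 0)) fun t =>
    (f (X + t • D + (t ^ 2 / 2) • W') - f X - t * dirDeriv f X D) / (t ^ 2 / 2)

/-- The sigma term of θ: `ψ*_{(P,D)}(W) = (θ''(P;D,·))*(W)`. -/
def sigmaTheta {ι κ : Type*} [Fintype ι] [Fintype κ] (P D W : Matrix ι κ ℝ) : EReal :=
  ⨆ Z : Matrix ι κ ℝ, ((minner W Z - dirDeriv2 specNorm P D Z : ℝ) : EReal)

/-- Lower second-order directional epiderivative of an EReal-valued function. -/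
def epiDeriv2 {ι κ : Type*} [Fintype ι] [Fintype κ] (g : Matrix ι κ ℝ → EReal)
    (X D W' : Matrix ι κ ℝ) : EReal :=
  liminf (fun p : ℝ × Matrix ι κ ℝ =>
      ((2 / p.1 ^ 2 : ℝ) : EReal) *
        (g (X + p.1 • D + (p.1 ^ 2 / 2) • p.2) - g X - (p.1 : ℝ) * epiDeriv g X D))
    ((nhdsWithin (0 : ℝ) (Set.Ioi 0)) ×ˢ nhds W')

/-- The sigma term of θ*: `φ*_{(W,H)}(P) = ((θ*)''(W;H,·))*(P)`. -/
def sigmaThetaStar {ι κ : Type*} [Fintype ι] [Fintype κ] (W H P : Matrix ι κ ℝ) : EReal :=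
  ⨆ Z : Matrix ι κ ℝ, (((minner P Z : ℝ) : EReal) - epiDeriv2 thetaStar W H Z)

/-- Polar cone with respect to the trace inner product. -/
def polarCone {ι κ : Type*} [Fintype ι] [Fintype κ] (K : Set (Matrix ι κ ℝ)) :
    Set (Matrix ι κ ℝ) :=
  {H | ∀ D ∈ K, minner H D ≤ 0}

/-- Rectangular diagonal matrix `[Diag σ  0]`. -/
def diagRect {m n : ℕ} (σ : Fin m → ℝ) : Matrix (Fin m) (Fin n) ℝ :=
  Matrix.of fun i j => if (j : ℕ) = (i : ℕ) then σ i else 0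

/-- Symmetric part `S(A₁)` of the left m×m block of an m×n matrix. -/
def symLeft {m n : ℕ} (hmn : m ≤ n) (A : Matrix (Fin m) (Fin n) ℝ) :
    Matrix (Fin m) (Fin m) ℝ :=
  Matrix.of fun i j => (A i (Fin.castLE hmn j) + A j (Fin.castLE hmn i)) / 2

/-- Skew-symmetric part `T(A₁)` of the left m×m block of an m×n matrix. -/
def skewLeft {m n : ℕ} (hmn : m ≤ n) (A : Matrix (Fin m) (Fin n) ℝ) :
    Matrix (Fin m) (Fin m) ℝ :=
  Matrix.of fun i j => (A i (Fin.castLE hmn j) - A j (Fin.castLE hmn i)) / 2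

/-- Quadratic form `xᵀ A x`. -/
def quadForm {m : ℕ} (A : Matrix (Fin m) (Fin m) ℝ) (x : Fin m → ℝ) : ℝ :=
  ∑ i, ∑ j, x i * A i j * x j

/-- Proximal mapping. -/
def prox {ι κ : Type*} [Fintype ι] [Fintype κ] (f : Matrix ι κ ℝ → ℝ)
    (Z : Matrix ι κ ℝ) : Matrix ι κ ℝ :=
  Classical.epsilon fun Y =>
    ∀ X, f Y + (1 / 2) * fnorm (Y - Z) ^ 2 ≤ f X + (1 / 2) * fnorm (X - Z) ^ 2

/-- Directional derivative of the proximal mapping. -/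
def proxDeriv {ι κ : Type*} [Fintype ι] [Fintype κ] (f : Matrix ι κ ℝ → ℝ)
    (Z D : Matrix ι κ ℝ) : Matrix ι κ ℝ :=
  limUnder (nhdsWithin (0 : ℝ) (Set.Ioi 0)) fun t =>
    t⁻¹ • (prox f (Z + t • D) - prox f Z)

end

section MatrixFacts

variable {ι κ : Type*} [Fintype ι] [Fintype κ]

theorem minner_eq_sum (A B : Matrix ι κ ℝ) : minner A B = ∑ i, ∑ j, A i j * B i j := by
  simp only [minner, Matrix.trace, Matrix.diag_apply, Matrix.mul_apply, Matrix.transpose_apply]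
  exact Finset.sum_comm

theorem minner_comm (A B : Matrix ι κ ℝ) : minner A B = minner B A := by
  simp only [minner_eq_sum, mul_comm]

theorem minner_add_left (A B C : Matrix ι κ ℝ) :
    minner (A + B) C = minner A C + minner B C := by
  simp [minner, Matrix.add_mul]

theorem minner_add_right (A B C : Matrix ι κ ℝ) :
    minner A (B + C) = minner A B + minner A C := by
  simp [minner, Matrix.mul_add]

theorem minner_smul_left (r : ℝ) (A B : Matrix ι κ ℝ) :
    minner (r • A) B = r * minner A B := by
  simp [minner]

theorem minner_smul_right (r : ℝ) (A B : Matrix ι κ ℝ) :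
    minner A (r • B) = r * minner A B := by
  simp [minner]

theorem continuous_minner_left (B : Matrix ι κ ℝ) : Continuous fun A => minner A B := by
  unfold minner
  fun_prop

theorem minner_conj (U : Matrix ι ι ℝ) (V : Matrix κ κ ℝ)
    (A B : Matrix ι κ ℝ) : minner (U * A * Vᵀ) B = minner A (Uᵀ * B * V) := by
  simp only [minner, Matrix.transpose_mul, Matrix.transpose_transpose]
  rw [Matrix.mul_assoc V, Matrix.trace_mul_comm, ← Matrix.mul_assoc]
  simp only [Matrix.mul_assoc]

theorem sum_mulVec_sq_le (A : Matrix ι κ ℝ) (x : κ → ℝ) :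
    ∑ i, (∑ j, A i j * x j) ^ 2 ≤ (∑ i, ∑ j, A i j ^ 2) * ∑ j, x j ^ 2 := by
  rw [Finset.sum_mul]
  exact Finset.sum_le_sum fun i _ => Finset.sum_mul_sq_le_sq_mul_sq _ _ _

theorem bddAbove_specNorm (A : Matrix ι κ ℝ) :
    BddAbove {r : ℝ | ∃ x : κ → ℝ, ∑ j, x j ^ 2 = 1 ∧
      r = Real.sqrt (∑ i, (∑ j, A i j * x j) ^ 2)} := by
  refine ⟨Real.sqrt (∑ i, ∑ j, A i j ^ 2), ?_⟩
  rintro r ⟨x, hx, rfl⟩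
  apply Real.sqrt_le_sqrt
  simpa [hx] using sum_mulVec_sq_le A x

theorem specNorm_nonneg (A : Matrix ι κ ℝ) : 0 ≤ specNorm A := by
  apply Real.sSup_nonneg
  rintro r ⟨x, _, rfl⟩
  exact Real.sqrt_nonneg _

theorem specNorm_le {A : Matrix ι κ ℝ} {c : ℝ} (hc : 0 ≤ c)
    (h : ∀ x : κ → ℝ, ∑ i, (∑ j, A i j * x j) ^ 2 ≤ c ^ 2 * ∑ j, x j ^ 2) :
    specNorm A ≤ c := by
  refine Real.sSup_le ?_ hc
  rintro r ⟨x, hx, rfl⟩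
  rw [Real.sqrt_le_left hc]
  simpa [hx] using h x

theorem sum_mulVec_sq_le_specNorm (A : Matrix ι κ ℝ) (x : κ → ℝ) :
    ∑ i, (∑ j, A i j * x j) ^ 2 ≤ specNorm A ^ 2 * ∑ j, x j ^ 2 := by
  have hs : 0 ≤ ∑ j, x j ^ 2 := Finset.sum_nonneg fun j _ => sq_nonneg _
  rcases hs.eq_or_lt with h0 | hpos
  · have := sum_mulVec_sq_le A x
    rw [← h0] at this ⊢
    simpa using this
  set r := Real.sqrt (∑ j, x j ^ 2) with hr
  have hrpos : 0 < r := Real.sqrt_pos.2 hpos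
  have hr2 : r ^ 2 = ∑ j, x j ^ 2 := Real.sq_sqrt hs
  have hmem : Real.sqrt (∑ i, (∑ j, A i j * (x j / r)) ^ 2) ≤ specNorm A := by
    refine le_csSup (bddAbove_specNorm A) ⟨fun j => x j / r, ?_, rfl⟩
    simp only [div_pow]
    rw [← Finset.sum_div, ← hr2, div_self (by positivity)]
  have heq : ∑ i, (∑ j, A i j * (x j / r)) ^ 2 = (∑ i, (∑ j, A i j * x j) ^ 2) / r ^ 2 := by
    rw [Finset.sum_div]
    refine Finset.sum_congr rfl fun i _ => ?_
    rw [← div_pow, Finset.sum_div]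
    simp only [mul_div_assoc]
  rw [heq, Real.sqrt_le_left (specNorm_nonneg A), div_le_iff₀ (by positivity), hr2] at hmem
  exact hmem

theorem specNorm_smul_le (A : Matrix ι κ ℝ) {c : ℝ} (hc : 0 ≤ c) :
    specNorm (c • A) ≤ c * specNorm A := by
  refine specNorm_le (mul_nonneg hc (specNorm_nonneg A)) fun x => ?_
  have h := mul_le_mul_of_nonneg_left (sum_mulVec_sq_le_specNorm A x) (sq_nonneg c)
  calc ∑ i, (∑ j, (c • A) i j * x j) ^ 2 = c ^ 2 * ∑ i, (∑ j, A i j * x j) ^ 2 := by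
        rw [Finset.mul_sum]
        refine Finset.sum_congr rfl fun i _ => ?_
        rw [← mul_pow, Finset.mul_sum]
        simp [mul_assoc]
    _ ≤ _ := by linarith

theorem specNorm_zero : specNorm (0 : Matrix ι κ ℝ) = 0 :=
  le_antisymm (specNorm_le le_rfl fun x => by simp) (specNorm_nonneg _)

theorem sum_mulVec_sq_of_orthogonal [DecidableEq ι] {U : Matrix ι ι ℝ} (hU : Uᵀ * U = 1)
    (x : ι → ℝ) : ∑ i, (∑ j, U i j * x j) ^ 2 = ∑ i, x i ^ 2 := by
  have h : (U *ᵥ x) ⬝ᵥ (U *ᵥ x) = x ⬝ᵥ x := by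
    rw [Matrix.dotProduct_mulVec, Matrix.vecMul_mulVec, hU, Matrix.vecMul_one]
  simpa [dotProduct, Matrix.mulVec, sq] using h

theorem specNorm_conj_le [DecidableEq ι] [DecidableEq κ] {U : Matrix ι ι ℝ} {V : Matrix κ κ ℝ}
    (hU : Uᵀ * U = 1) (hV : V * Vᵀ = 1) (A : Matrix ι κ ℝ) :
    specNorm (U * A * Vᵀ) ≤ specNorm A := by
  refine specNorm_le (specNorm_nonneg A) fun x => ?_
  have h1 : ∀ i, ∑ j, (U * A * Vᵀ) i j * x j =
      ∑ j, U i j * ∑ k, A j k * ∑ l, Vᵀ k l * x l := fun i => by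
    have : (U * A * Vᵀ) *ᵥ x = U *ᵥ (A *ᵥ (Vᵀ *ᵥ x)) := by simp [Matrix.mul_assoc]
    exact congrFun this i
  simp only [h1]
  rw [sum_mulVec_sq_of_orthogonal hU]
  refine (sum_mulVec_sq_le_specNorm A _).trans_eq ?_
  rw [sum_mulVec_sq_of_orthogonal (U := Vᵀ) (by simpa using hV)]

/-- A bilinear form is bounded by a multiple of the product of the Euclidean norms. -/
theorem sum_bilin_le_specNorm (A : Matrix ι κ ℝ) (u : ι → ℝ) (v : κ → ℝ) :
    |∑ i, ∑ j, u i * A i j * v j| ≤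
      specNorm A * (Real.sqrt (∑ i, u i ^ 2) * Real.sqrt (∑ j, v j ^ 2)) := by
  have hu : 0 ≤ ∑ i, u i ^ 2 := Finset.sum_nonneg fun j _ => sq_nonneg _
  have hv : 0 ≤ ∑ i, v i ^ 2 := Finset.sum_nonneg fun j _ => sq_nonneg _
  have hA := specNorm_nonneg A
  apply abs_le_of_sq_le_sq _ (by positivity)
  rw [mul_pow, mul_pow, Real.sq_sqrt hu, Real.sq_sqrt hv]
  calc (∑ i, ∑ j, u i * A i j * v j) ^ 2 = (∑ i, u i * ∑ j, A i j * v j) ^ 2 := by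
        simp only [Finset.mul_sum, mul_assoc]
    _ ≤ (∑ i, u i ^ 2) * ∑ i, (∑ j, A i j * v j) ^ 2 := Finset.sum_mul_sq_le_sq_mul_sq _ _ _
    _ ≤ (∑ i, u i ^ 2) * (specNorm A ^ 2 * ∑ j, v j ^ 2) :=
        mul_le_mul_of_nonneg_left (sum_mulVec_sq_le_specNorm A v) hu
    _ = _ := by ring

/-- The polar of the spectral norm unit ball, that is, the nuclear norm unit ball. -/
def nuclearBall (ι κ : Type*) [Fintype ι] [Fintype κ] : Set (Matrix ι κ ℝ) :=
  {X | ∀ Y, minner X Y ≤ specNorm Y}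

theorem thetaStar_eq_zero {X : Matrix ι κ ℝ} (h : X ∈ nuclearBall ι κ) : thetaStar X = 0 := by
  apply le_antisymm
  · refine iSup_le fun Y => ?_
    have := h Y
    exact_mod_cast (by linarith : minner X Y - specNorm Y ≤ 0)
  · refine le_iSup_of_le 0 ?_
    simp [minner, specNorm_zero]

theorem thetaStar_eq_top {X : Matrix ι κ ℝ} (h : X ∉ nuclearBall ι κ) : thetaStar X = ⊤ := by
  simp only [nuclearBall, Set.mem_ofPred_eq, not_forall, not_le] at h
  obtain ⟨Y, hY⟩ := h
  rw [EReal.eq_top_iff_forall_lt]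
  intro y
  have hd : 0 < minner X Y - specNorm Y := by linarith
  set c := (|y| + 1) / (minner X Y - specNorm Y) with hc
  have hc0 : 0 ≤ c := by positivity
  refine lt_of_lt_of_le ?_ (le_iSup _ (c • Y))
  have h1 := specNorm_smul_le Y hc0
  have h2 : c * (minner X Y - specNorm Y) = |y| + 1 := by
    rw [hc]; field_simp
  rw [EReal.coe_lt_coe_iff, minner_smul_right]
  nlinarith [le_abs_self y]

end MatrixFacts

section Epiderivatives

theorem liminf_eq_zero_of_frequently {γ : Type*} {F : Filter γ} {f : γ → EReal}
    (h0 : ∀ᶠ p in F, 0 ≤ f p) (hf : ∃ᶠ p in F, f p = 0) : liminf f F = 0 :=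
  le_antisymm (liminf_le_of_frequently_le' (hf.mono fun _ h => h.le))
    (le_liminf_of_le (by isBoundedDefault) h0)

theorem liminf_eq_top_of_not_frequently {γ : Type*} {F : Filter γ} {f : γ → EReal} {p : γ → Prop}
    (htop : ∀ᶠ x in F, ¬ p x → f x = ⊤) (hf : ¬ ∃ᶠ x in F, p x) : liminf f F = ⊤ := by
  rw [not_frequently] at hf
  refine top_le_iff.1 (le_liminf_of_le (by isBoundedDefault) ?_)
  filter_upwards [htop, hf] with x h1 h2 using (h1 h2).ge

theorem eventually_fst_pos {ι κ : Type*} (D : Matrix ι κ ℝ) :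
    ∀ᶠ p : ℝ × Matrix ι κ ℝ in (nhdsWithin (0 : ℝ) (Set.Ioi 0)) ×ˢ nhds D, 0 < p.1 :=
  tendsto_fst.eventually self_mem_nhdsWithin

variable {ι κ : Type*} [Fintype ι] [Fintype κ]

open Classical in
theorem epiDeriv_thetaStar {W : Matrix ι κ ℝ} (hW : W ∈ nuclearBall ι κ) (D : Matrix ι κ ℝ) :
    epiDeriv thetaStar W D =
      if ∃ᶠ p : ℝ × Matrix ι κ ℝ in (nhdsWithin (0 : ℝ) (Set.Ioi 0)) ×ˢ nhds D,
        W + p.1 • p.2 ∈ nuclearBall ι κ then 0 else ⊤ := by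
  have htop : ∀ p : ℝ × Matrix ι κ ℝ, 0 < p.1 → W + p.1 • p.2 ∉ nuclearBall ι κ →
      (((p.1)⁻¹ : ℝ) : EReal) * (thetaStar (W + p.1 • p.2) - thetaStar W) = ⊤ := by
    intro p hp hn
    rw [thetaStar_eq_top hn, thetaStar_eq_zero hW, sub_zero]
    exact EReal.coe_mul_top_of_pos (inv_pos.2 hp)
  have hzero : ∀ p : ℝ × Matrix ι κ ℝ, W + p.1 • p.2 ∈ nuclearBall ι κ →
      (((p.1)⁻¹ : ℝ) : EReal) * (thetaStar (W + p.1 • p.2) - thetaStar W) = 0 := by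
    intro p hn
    rw [thetaStar_eq_zero hn, thetaStar_eq_zero hW, sub_zero, mul_zero]
  unfold epiDeriv
  split_ifs with h
  · refine liminf_eq_zero_of_frequently ?_ (h.mono hzero)
    filter_upwards [eventually_fst_pos D] with p hp
    by_cases hm : W + p.1 • p.2 ∈ nuclearBall ι κ
    · exact (hzero p hm).ge
    · rw [htop p hp hm]; exact le_top
  · exact liminf_eq_top_of_not_frequently ((eventually_fst_pos D).mono htop) h

open Classical in
theorem epiDeriv2_thetaStar {W H : Matrix ι κ ℝ} (hW : W ∈ nuclearBall ι κ)
    (hH : epiDeriv thetaStar W H = 0) (D : Matrix ι κ ℝ) :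
    epiDeriv2 thetaStar W H D =
      if ∃ᶠ p : ℝ × Matrix ι κ ℝ in (nhdsWithin (0 : ℝ) (Set.Ioi 0)) ×ˢ nhds D,
        W + p.1 • H + (p.1 ^ 2 / 2) • p.2 ∈ nuclearBall ι κ then 0 else ⊤ := by
  have htop : ∀ p : ℝ × Matrix ι κ ℝ, 0 < p.1 →
      W + p.1 • H + (p.1 ^ 2 / 2) • p.2 ∉ nuclearBall ι κ →
      ((2 / p.1 ^ 2 : ℝ) : EReal) * (thetaStar (W + p.1 • H + (p.1 ^ 2 / 2) • p.2)
        - thetaStar W - (p.1 : ℝ) * epiDeriv thetaStar W H) = ⊤ := by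
    intro p hp hn
    rw [thetaStar_eq_top hn, thetaStar_eq_zero hW, hH, mul_zero, sub_zero, sub_zero]
    exact EReal.coe_mul_top_of_pos (by positivity)
  have hzero : ∀ p : ℝ × Matrix ι κ ℝ,
      W + p.1 • H + (p.1 ^ 2 / 2) • p.2 ∈ nuclearBall ι κ →
      ((2 / p.1 ^ 2 : ℝ) : EReal) * (thetaStar (W + p.1 • H + (p.1 ^ 2 / 2) • p.2)
        - thetaStar W - (p.1 : ℝ) * epiDeriv thetaStar W H) = 0 := by
    intro p hn
    rw [thetaStar_eq_zero hn, thetaStar_eq_zero hW, hH, mul_zero, sub_zero, sub_zero, mul_zero]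
  unfold epiDeriv2
  split_ifs with h
  · refine liminf_eq_zero_of_frequently ?_ (h.mono hzero)
    filter_upwards [eventually_fst_pos D] with p hp
    by_cases hm : W + p.1 • H + (p.1 ^ 2 / 2) • p.2 ∈ nuclearBall ι κ
    · exact (hzero p hm).ge
    · rw [htop p hp hm]; exact le_top
  · exact liminf_eq_top_of_not_frequently ((eventually_fst_pos D).mono htop) h

theorem epiDeriv_eq_zero_of_mem_critThetaStar {W P H : Matrix ι κ ℝ} (hW : W ∈ nuclearBall ι κ)
    (hcrit : H ∈ critThetaStar W P) : epiDeriv thetaStar W H = 0 ∧ minner H P = 0 := by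
  have h : epiDeriv thetaStar W H = ((minner H P : ℝ) : EReal) := hcrit
  rw [epiDeriv_thetaStar hW] at h ⊢
  split_ifs at h ⊢
  · exact ⟨rfl, by exact_mod_cast h.symm⟩
  · exact absurd h.symm (EReal.coe_ne_top _)

/-- Criticality together with a vanishing sigma term forces `⟨H, Y⟩ ≤ 0` for every direction `Y`
orthogonal to `W` along which the spectral norm grows at most quadratically from `P`. -/
theorem minner_nonpos_of_sigma_zero {W P H : Matrix ι κ ℝ} (hW : W ∈ nuclearBall ι κ)
    (hWP : minner W P = specNorm P) (hcrit : H ∈ critThetaStar W P)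
    (hσ : sigmaThetaStar W H P = 0) {Y : Matrix ι κ ℝ} (hWY : minner W Y = 0) {C : ℝ}
    (hC : ∀ s : ℝ, 0 < s → specNorm (P + s • Y) ≤ specNorm P + C * s ^ 2) :
    minner H Y ≤ 0 := by
  obtain ⟨hH0, hHP⟩ := epiDeriv_eq_zero_of_mem_critThetaStar hW hcrit
  have key : ∀ δ : ℝ, 0 < δ → minner H Y ≤ (C + 2) * δ := by
    intro δ hδ
    have hlt : ((-(2 * δ ^ 2) : ℝ) : EReal) < sigmaThetaStar W H P := by
      rw [hσ]; exact_mod_cast (by nlinarith [sq_pos_of_pos hδ] : -(2 * δ ^ 2) < 0)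
    obtain ⟨Z, hZ⟩ := lt_iSup_iff.1 hlt
    rw [epiDeriv2_thetaStar hW hH0] at hZ
    split_ifs at hZ with hfreq
    swap
    · simp at hZ
    rw [sub_zero, EReal.coe_lt_coe_iff, minner_comm] at hZ
    set M := |minner Z Y| + 1 with hM
    have e1 : ∀ᶠ p : ℝ × Matrix ι κ ℝ in (nhdsWithin (0 : ℝ) (Set.Ioi 0)) ×ˢ nhds Z,
        -(2 * δ ^ 2) < minner p.2 P :=
      tendsto_snd.eventually
        ((continuous_minner_left P).continuousAt.eventually (lt_mem_nhds hZ))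
    have e2 : ∀ᶠ p : ℝ × Matrix ι κ ℝ in (nhdsWithin (0 : ℝ) (Set.Ioi 0)) ×ˢ nhds Z,
        -M < minner p.2 Y :=
      tendsto_snd.eventually ((continuous_minner_left Y).continuousAt.eventually
        (lt_mem_nhds (by linarith [neg_abs_le (minner Z Y)])))
    have e3 : ∀ᶠ p : ℝ × Matrix ι κ ℝ in (nhdsWithin (0 : ℝ) (Set.Ioi 0)) ×ˢ nhds Z,
        p.1 < δ / M :=
      tendsto_fst.eventually (mem_nhdsWithin_of_mem_nhds (gt_mem_nhds (by positivity)))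
    obtain ⟨⟨t, Z'⟩, hmem, h1, h2, h3, ht⟩ :=
      (hfreq.and_eventually (e1.and (e2.and (e3.and (eventually_fst_pos Z))))).exists
    simp only at hmem h1 h2 h3 ht
    have hb := (hmem (P + (δ * t) • Y)).trans (hC (δ * t) (by positivity))
    simp only [minner_add_left, minner_add_right, minner_smul_left, minner_smul_right, hWP, hHP,
      hWY] at hb
    rw [lt_div_iff₀ (by positivity)] at h3
    have hb' : δ * t ^ 2 * (minner H Y) ≤ δ * t ^ 2 * ((C + 2) * δ) := by
      have k1 : 0 ≤ t ^ 2 / 2 * (minner Z' P + 2 * δ ^ 2) :=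
        mul_nonneg (by positivity) (by linarith)
      have k2 : 0 ≤ δ * t ^ 3 / 2 * (minner Z' Y + M) :=
        mul_nonneg (by positivity) (by linarith)
      have k3 : 0 ≤ δ * t ^ 2 / 2 * (δ - t * M) := mul_nonneg (by positivity) (by linarith)
      have k4 : 0 ≤ δ ^ 2 * t ^ 2 := by positivity
      linarith
    exact le_of_mul_le_mul_left hb' (by positivity)
  by_contra! hpos
  have hC' : 0 < |C| + 2 := by positivity
  have := key (minner H Y / (2 * (|C| + 2))) (by positivity)
  have h2 : (C + 2) * (minner H Y / (2 * (|C| + 2))) ≤ minner H Y / 2 := by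
    rw [← mul_div_assoc, div_le_div_iff₀ (by positivity) (by positivity)]
    nlinarith [le_abs_self C]
  linarith

/-- A parabolic arc in the nuclear ball, orthogonal to `P` up to second order, gives criticality
and a vanishing sigma term. -/
theorem crit_and_sigma_zero_of_arc {W P H Z : Matrix ι κ ℝ} (hW : W ∈ nuclearBall ι κ)
    (hWP : minner W P = specNorm P) (hHP : minner H P = 0) (hZP : minner Z P = 0)
    (harc : ∀ᶠ t : ℝ in nhdsWithin (0 : ℝ) (Set.Ioi 0),
      W + t • H + (t ^ 2 / 2) • Z ∈ nuclearBall ι κ) :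
    H ∈ critThetaStar W P ∧ sigmaThetaStar W H P = 0 := by
  have hH0 : epiDeriv thetaStar W H = 0 := by
    rw [epiDeriv_thetaStar hW, if_pos]
    have ht : Tendsto (fun t : ℝ => (t, H + (t / 2) • Z)) (nhdsWithin (0 : ℝ) (Set.Ioi 0))
        ((nhdsWithin (0 : ℝ) (Set.Ioi 0)) ×ˢ nhds H) := by
      refine tendsto_id.prodMk (tendsto_nhdsWithin_of_tendsto_nhds ?_)
      have : Continuous fun t : ℝ => H + (t / 2) • Z := by fun_prop
      simpa using this.tendsto 0
    refine ht.frequently (harc.mono fun t h => ?_).frequently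
    convert h using 1
    simp only [smul_add, smul_smul, add_assoc]
    congr 3
    ring
  refine ⟨by rw [critThetaStar, Set.mem_ofPred_eq, hH0, hHP]; rfl, ?_⟩
  apply le_antisymm
  · refine iSup_le fun Y => ?_
    rw [epiDeriv2_thetaStar hW hH0]
    split_ifs with hfreq
    swap
    · simp
    rw [sub_zero]
    by_contra! hpos
    have hpos' : 0 < minner Y P := by rw [minner_comm]; exact_mod_cast hpos
    have e1 : ∀ᶠ p : ℝ × Matrix ι κ ℝ in (nhdsWithin (0 : ℝ) (Set.Ioi 0)) ×ˢ nhds Y,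
        0 < minner p.2 P :=
      tendsto_snd.eventually
        ((continuous_minner_left P).continuousAt.eventually (lt_mem_nhds hpos'))
    obtain ⟨⟨t, Z'⟩, hmem, h1, ht⟩ :=
      (hfreq.and_eventually (e1.and (eventually_fst_pos Y))).exists
    simp only at hmem h1 ht
    have hb := hmem P
    simp only [minner_add_left, minner_smul_left, hWP, hHP] at hb
    have : 0 < t ^ 2 / 2 * minner Z' P := by positivity
    linarith
  · refine le_iSup_of_le Z ?_
    rw [epiDeriv2_thetaStar hW hH0, if_pos, minner_comm, hZP]
    · simp
    · have ht : Tendsto (fun t : ℝ => (t, Z)) (nhdsWithin (0 : ℝ) (Set.Ioi 0))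
          ((nhdsWithin (0 : ℝ) (Set.Ioi 0)) ×ˢ nhds Z) := tendsto_id.prodMk tendsto_const_nhds
      exact ht.frequently harc.frequently

end Epiderivatives

section RectangularDiagonal

theorem sum_eq_sum_castLE {m n : ℕ} (hmn : m ≤ n) (f : Fin n → ℝ)
    (hf : ∀ j : Fin n, m ≤ (j : ℕ) → f j = 0) : ∑ j, f j = ∑ i, f (Fin.castLE hmn i) := by
  symm
  refine Fintype.sum_of_injective _ (Fin.castLE_injective hmn) _ _ (fun j hj => ?_) fun _ => rfl
  refine hf j (not_lt.1 fun h => hj ⟨⟨j, h⟩, rfl⟩)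

theorem sum_castLE_le {m n : ℕ} (hmn : m ≤ n) (f : Fin n → ℝ) (hf : ∀ j, 0 ≤ f j) :
    ∑ i, f (Fin.castLE hmn i) ≤ ∑ j, f j := by
  have h : ∑ i, f (Fin.castLE hmn i) = ∑ j ∈ Finset.univ.map (Fin.castLEEmb hmn), f j := by
    simp
  rw [h]
  exact Finset.sum_le_sum_of_subset_of_nonneg (Finset.subset_univ _) fun j _ _ => hf j

theorem sum_diagRect_mul {m n : ℕ} (hmn : m ≤ n) (d : Fin m → ℝ) (i : Fin m) (x : Fin n → ℝ) :
    ∑ j, (diagRect d : Matrix (Fin m) (Fin n) ℝ) i j * x j = d i * x (Fin.castLE hmn i) := by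
  rw [Finset.sum_eq_single (Fin.castLE hmn i)]
  · simp [diagRect]
  · intro j _ hj
    have : (j : ℕ) ≠ i := fun h => hj (Fin.ext h)
    simp [diagRect, this]
  · simp

theorem minner_diagRect {m n : ℕ} (hmn : m ≤ n) (d : Fin m → ℝ) (A : Matrix (Fin m) (Fin n) ℝ) :
    minner (diagRect d) A = ∑ i, d i * A i (Fin.castLE hmn i) := by
  rw [minner_eq_sum]
  exact Finset.sum_congr rfl fun i _ => sum_diagRect_mul hmn d i _

theorem diagRect_castLE {m n : ℕ} (hmn : m ≤ n) (d : Fin m → ℝ) (i j : Fin m) :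
    (diagRect d : Matrix (Fin m) (Fin n) ℝ) i (Fin.castLE hmn j) = if i = j then d i else 0 := by
  simp [diagRect, Fin.ext_iff, eq_comm]

theorem diagRect_of_le {m n : ℕ} (d : Fin m → ℝ) (i : Fin m) (j : Fin n) (hj : m ≤ (j : ℕ)) :
    (diagRect d : Matrix (Fin m) (Fin n) ℝ) i j = 0 := by
  have : (j : ℕ) ≠ i := by omega
  simp [diagRect, this]

theorem conj_mem_nuclearBall {ι κ : Type*} [Fintype ι] [Fintype κ] [DecidableEq ι]
    [DecidableEq κ] {U : Matrix ι ι ℝ} {V : Matrix κ κ ℝ} (hU : U * Uᵀ = 1) (hV : Vᵀ * V = 1)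
    {X : Matrix ι κ ℝ} (hX : X ∈ nuclearBall ι κ) : U * X * Vᵀ ∈ nuclearBall ι κ := by
  intro Y
  rw [minner_conj]
  refine (hX _).trans ?_
  have := specNorm_conj_le (U := Uᵀ) (V := Vᵀ) (by simpa using hU) (by simpa using hV) Y
  simpa using this

open scoped MatrixOrder Matrix.Norms.L2Operator in
theorem mem_nuclearBall_of_posSemidef {m n : ℕ} (hmn : m ≤ n) {X : Matrix (Fin m) (Fin n) ℝ}
    (hpsd : (X.submatrix id (Fin.castLE hmn)).PosSemidef)
    (htr : ∑ i, X i (Fin.castLE hmn i) = 1)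
    (h0 : ∀ (i : Fin m) (j : Fin n), m ≤ (j : ℕ) → X i j = 0) :
    X ∈ nuclearBall (Fin m) (Fin n) := by
  intro Y
  obtain ⟨S, hS⟩ := CStarAlgebra.nonneg_iff_eq_star_mul_self.mp hpsd.nonneg
  have hX : ∀ i j, X i (Fin.castLE hmn j) = ∑ k, S k i * S k j := fun i j => by
    have := congrFun (congrFun hS i) j
    simpa [Matrix.mul_apply, Matrix.star_eq_conjTranspose] using this
  set Y' : Matrix (Fin m) (Fin m) ℝ := Y.submatrix id (Fin.castLE hmn) with hY'
  have hle : specNorm Y' ≤ specNorm Y := by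
    refine specNorm_le (specNorm_nonneg Y) fun x => ?_
    set z : Fin n → ℝ := fun j => if h : (j : ℕ) < m then x ⟨j, h⟩ else 0 with hz
    have hzx : ∀ i, z (Fin.castLE hmn i) = x i := fun i => by simp [hz]
    have hz0 : ∀ j : Fin n, m ≤ (j : ℕ) → z j = 0 := fun j hj => by simp [hz, hj]
    have := sum_mulVec_sq_le_specNorm Y z
    rw [sum_eq_sum_castLE hmn (fun j => z j ^ 2) (fun j hj => by simp [hz0 j hj])] at this
    simp only [fun i => sum_eq_sum_castLE hmn (fun j => Y i j * z j)
      (fun j hj => by simp [hz0 j hj]), hzx] at this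
    exact this
  have h1 : minner X Y = ∑ k, ∑ i, ∑ j, S k i * Y' i j * S k j := by
    rw [minner_eq_sum]
    simp only [fun i => sum_eq_sum_castLE hmn (fun j => X i j * Y i j)
      (fun j hj => by simp [h0 i j hj]), hX, Finset.sum_mul]
    simp only [fun i => Finset.sum_comm (s := (Finset.univ : Finset (Fin m)))
      (t := (Finset.univ : Finset (Fin m)))
      (f := fun j k => S k i * S k j * Y i (Fin.castLE hmn j))]
    rw [Finset.sum_comm]
    refine Finset.sum_congr rfl fun k _ => Finset.sum_congr rfl fun i _ =>
      Finset.sum_congr rfl fun j _ => ?_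
    simp only [hY', Matrix.submatrix_apply, id]
    ring
  have h2 : ∀ k, ∑ i, ∑ j, S k i * Y' i j * S k j ≤ specNorm Y' * ∑ i, S k i ^ 2 := fun k => by
    have := (le_abs_self _).trans (sum_bilin_le_specNorm Y' (S k) (S k))
    rwa [Real.mul_self_sqrt (Finset.sum_nonneg fun i _ => sq_nonneg _)] at this
  calc minner X Y ≤ ∑ k, specNorm Y' * ∑ i, S k i ^ 2 := by
        rw [h1]; exact Finset.sum_le_sum fun k _ => h2 k
    _ = specNorm Y' := by
        rw [← Finset.mul_sum, Finset.sum_comm]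
        simp only [hX, ← sq] at htr
        rw [htr, mul_one]
    _ ≤ _ := hle

theorem diagRect_mem_nuclearBall {m n : ℕ} (hmn : m ≤ n) {w : Fin m → ℝ} (hw : ∀ i, 0 ≤ w i)
    (hw1 : ∑ i, w i = 1) :
    (diagRect w : Matrix (Fin m) (Fin n) ℝ) ∈ nuclearBall (Fin m) (Fin n) := by
  refine mem_nuclearBall_of_posSemidef hmn ?_ ?_ (diagRect_of_le w)
  · have : (diagRect w : Matrix (Fin m) (Fin n) ℝ).submatrix id (Fin.castLE hmn) =
        Matrix.diagonal w := by
      ext i j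
      simp [diagRect_castLE, Matrix.diagonal_apply]
    rw [this]
    exact Matrix.PosSemidef.diagonal hw
  · simpa [diagRect_castLE] using hw1

/-- For finitely many nonnegative numbers bounded by `lam`, those different from `lam` have
squares uniformly bounded away from `lam ^ 2`. -/
theorem exists_sq_gap {ι : Type*} [Finite ι] {q : ι → ℝ} {lam : ℝ} (h0 : ∀ i, 0 ≤ q i)
    (hle : ∀ i, q i ≤ lam) : ∃ δ > 0, ∀ i, q i ≠ lam → q i ^ 2 + δ ≤ lam ^ 2 := by
  have : ∀ᶠ δ : ℝ in nhdsWithin 0 (Set.Ioi 0), ∀ i, q i ≠ lam → q i ^ 2 + δ ≤ lam ^ 2 := by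
    rw [eventually_all]
    intro i
    by_cases hi : q i = lam
    · exact Eventually.of_forall fun _ h => absurd hi h
    have hlt : q i < lam := lt_of_le_of_ne (hle i) hi
    have hpos : 0 < lam ^ 2 - q i ^ 2 := by nlinarith [h0 i]
    filter_upwards [mem_nhdsWithin_of_mem_nhds (gt_mem_nhds hpos)] with δ hδ _
    have : δ < lam ^ 2 - q i ^ 2 := hδ
    linarith
  obtain ⟨δ, h, hδ⟩ := (this.and self_mem_nhdsWithin).exists
  exact ⟨δ, hδ, h⟩

/-- If the top block of `Y` has nonpositive quadratic form, then the spectral norm of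
`diagRect p + s • Y` exceeds that of `diagRect p` by at most a multiple of `s ^ 2`. -/
theorem exists_specNorm_diagRect_add_le {m n : ℕ} (hmn : m ≤ n) {p : Fin m → ℝ} {lam : ℝ}
    (hlam : 0 < lam) (hp0 : ∀ i, 0 ≤ p i) (hple : ∀ i, p i ≤ lam) (Y : Matrix (Fin m) (Fin n) ℝ)
    (hY : ∀ x : Fin m → ℝ, (∀ i, p i ≠ lam → x i = 0) →
      ∑ i, ∑ j, x i * Y i (Fin.castLE hmn j) * x j ≤ 0) :
    ∃ C : ℝ, ∀ s : ℝ, 0 < s →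
      specNorm ((diagRect p : Matrix (Fin m) (Fin n) ℝ) + s • Y) ≤ lam + C * s ^ 2 := by
  set q : Fin n → ℝ := fun j => if h : (j : ℕ) < m then p ⟨j, h⟩ else 0 with hq
  have hqp : ∀ i, q (Fin.castLE hmn i) = p i := fun i => by simp [hq]
  have hq0 : ∀ j, 0 ≤ q j := fun j => by
    simp only [hq]; split_ifs
    · exact hp0 _
    · exact le_rfl
  have hqle : ∀ j, q j ≤ lam := fun j => by
    simp only [hq]; split_ifs
    · exact hple _
    · exact hlam.le
  obtain ⟨δ, hδ, hgap⟩ := exists_sq_gap hq0 hqle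
  set K := specNorm Y with hK
  have hK0 : 0 ≤ K := specNorm_nonneg Y
  set C' := 4 * lam ^ 2 * K ^ 2 / δ + K ^ 2 with hC'
  have hC'0 : 0 ≤ C' := by positivity
  refine ⟨C' / (2 * lam), fun s hs => specNorm_le (by positivity) fun x => ?_⟩
  set N := ∑ j, x j ^ 2 with hN
  set a : Fin n → ℝ := fun j => if q j = lam then x j else 0 with ha
  set b : Fin n → ℝ := fun j => if q j = lam then 0 else x j with hb
  set B := ∑ j, b j ^ 2 with hB
  have hN0 : 0 ≤ N := Finset.sum_nonneg fun j _ => sq_nonneg _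
  have hB0 : 0 ≤ B := Finset.sum_nonneg fun j _ => sq_nonneg _
  have hxab : ∀ j, x j = a j + b j := fun j => by
    simp only [ha, hb]; split_ifs <;> simp
  set y : Fin m → ℝ := fun i => ∑ j, Y i j * x j with hy
  have F1 : ∑ i, (p i * x (Fin.castLE hmn i)) ^ 2 ≤ lam ^ 2 * N - δ * B := by
    calc ∑ i, (p i * x (Fin.castLE hmn i)) ^ 2
        = ∑ i, (fun j => (q j * x j) ^ 2) (Fin.castLE hmn i) := by simp [hqp]
      _ ≤ ∑ j, (q j * x j) ^ 2 := sum_castLE_le hmn (fun j => (q j * x j) ^ 2) fun j => sq_nonneg (q j * x j)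
      _ ≤ ∑ j, (lam ^ 2 * x j ^ 2 - δ * b j ^ 2) := by
          refine Finset.sum_le_sum fun j _ => ?_
          by_cases hj : q j = lam
          · simp [hb, hj, mul_pow]
          · simp only [hb, hj, if_false]
            nlinarith [hgap j hj, sq_nonneg (x j)]
      _ = _ := by rw [Finset.sum_sub_distrib, ← Finset.mul_sum, ← Finset.mul_sum]
  have F2 : ∑ i, p i * x (Fin.castLE hmn i) * y i ≤
      2 * (lam * (K * (Real.sqrt N * Real.sqrt B))) := by
    have e : ∀ i, p i * x (Fin.castLE hmn i) * y i =
        lam * ∑ j, a (Fin.castLE hmn i) * Y i (Fin.castLE hmn j) * a (Fin.castLE hmn j)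
        + lam * ∑ j, a (Fin.castLE hmn i) * Y i j * b j
        + ∑ j, (p i * b (Fin.castLE hmn i)) * Y i j * x j := fun i => by
      have e1 : p i * x (Fin.castLE hmn i) =
          lam * a (Fin.castLE hmn i) + p i * b (Fin.castLE hmn i) := by
        simp only [ha, hb, hqp]
        split_ifs with h
        · rw [h]; ring
        · ring
      have e2 : y i = ∑ j, Y i (Fin.castLE hmn j) * a (Fin.castLE hmn j) + ∑ j, Y i j * b j := by
        rw [← sum_eq_sum_castLE hmn (fun j => Y i j * a j), ← Finset.sum_add_distrib]
        · simp only [hy, hxab, mul_add]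
        · intro j hj
          have : q j ≠ lam := by simp [hq, not_lt.2 hj, hlam.ne]
          simp [ha, this]
      have e3 : ∑ j, (p i * b (Fin.castLE hmn i)) * Y i j * x j =
          p i * b (Fin.castLE hmn i) * y i := by
        simp only [hy, Finset.mul_sum, mul_assoc]
      rw [e3, e1, add_mul]
      nth_rewrite 1 [e2]
      simp only [mul_add, Finset.mul_sum, mul_assoc]
    simp only [e, Finset.sum_add_distrib, ← Finset.mul_sum]
    have t1 := hY (fun i => a (Fin.castLE hmn i)) fun i hi => by simp [ha, hqp, hi]
    have t2 := (le_abs_self _).trans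
      (sum_bilin_le_specNorm Y (fun i => a (Fin.castLE hmn i)) b)
    have t3 := (le_abs_self _).trans
      (sum_bilin_le_specNorm Y (fun i => p i * b (Fin.castLE hmn i)) x)
    have s2 : Real.sqrt (∑ i, a (Fin.castLE hmn i) ^ 2) ≤ Real.sqrt N := by
      apply Real.sqrt_le_sqrt
      refine (sum_castLE_le hmn (fun j => a j ^ 2) fun j => sq_nonneg _).trans ?_
      refine Finset.sum_le_sum fun j _ => ?_
      simp only [ha]; split_ifs
      · exact le_rfl
      · simpa using sq_nonneg (x j)
    have s3 : Real.sqrt (∑ i, (p i * b (Fin.castLE hmn i)) ^ 2) ≤ lam * Real.sqrt B := by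
      rw [Real.sqrt_le_left (by positivity), mul_pow, Real.sq_sqrt hB0]
      have := sum_castLE_le hmn (fun j => b j ^ 2) fun j => sq_nonneg _
      refine le_trans ?_ (mul_le_mul_of_nonneg_left this (sq_nonneg lam))
      rw [Finset.mul_sum]
      refine Finset.sum_le_sum fun i _ => ?_
      rw [mul_pow]
      exact mul_le_mul_of_nonneg_right (pow_le_pow_left₀ (hp0 i) (hple i) 2) (sq_nonneg _)
    have u2 : K * (Real.sqrt (∑ i, a (Fin.castLE hmn i) ^ 2) * Real.sqrt B) ≤
        K * (Real.sqrt N * Real.sqrt B) := by gcongr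
    have u3 : K * (Real.sqrt (∑ i, (p i * b (Fin.castLE hmn i)) ^ 2) * Real.sqrt N) ≤
        K * ((lam * Real.sqrt B) * Real.sqrt N) := by gcongr
    have v1 := mul_nonpos_of_nonneg_of_nonpos hlam.le t1
    have v2 := mul_le_mul_of_nonneg_left (t2.trans u2) hlam.le
    have v3 := t3.trans u3
    linarith
  have F3 : ∑ i, y i ^ 2 ≤ K ^ 2 * N := sum_mulVec_sq_le_specNorm Y x
  have hsum : ∑ i, (∑ j, ((diagRect p : Matrix (Fin m) (Fin n) ℝ) + s • Y) i j * x j) ^ 2 =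
      ∑ i, (p i * x (Fin.castLE hmn i)) ^ 2 + 2 * s * ∑ i, p i * x (Fin.castLE hmn i) * y i +
        s ^ 2 * ∑ i, y i ^ 2 := by
    rw [Finset.mul_sum, Finset.mul_sum, ← Finset.sum_add_distrib, ← Finset.sum_add_distrib]
    refine Finset.sum_congr rfl fun i _ => ?_
    have : ∑ j, ((diagRect p : Matrix (Fin m) (Fin n) ℝ) + s • Y) i j * x j =
        p i * x (Fin.castLE hmn i) + s * y i := by
      simp only [Matrix.add_apply, add_mul, Finset.sum_add_distrib, sum_diagRect_mul hmn, hy,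
        Finset.mul_sum, Matrix.smul_apply, smul_eq_mul, mul_assoc]
    rw [this]; ring
  have hyoung : 4 * s * lam * K * (Real.sqrt N * Real.sqrt B) ≤
      δ * B + s ^ 2 * (4 * lam ^ 2 * K ^ 2 / δ) * N := by
    have h := mul_nonneg hδ.le (sq_nonneg (Real.sqrt B - 2 * s * lam * K / δ * Real.sqrt N))
    have hexp : δ * (Real.sqrt B - 2 * s * lam * K / δ * Real.sqrt N) ^ 2 =
        δ * Real.sqrt B ^ 2 - 4 * s * lam * K * (Real.sqrt N * Real.sqrt B) +
          s ^ 2 * (4 * lam ^ 2 * K ^ 2 / δ) * Real.sqrt N ^ 2 := by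
      field_simp
      ring
    rw [hexp, Real.sq_sqrt hB0, Real.sq_sqrt hN0] at h
    linarith
  have hsq : lam ^ 2 + C' * s ^ 2 ≤ (lam + C' / (2 * lam) * s ^ 2) ^ 2 := by
    have : (lam + C' / (2 * lam) * s ^ 2) ^ 2 =
        lam ^ 2 + C' * s ^ 2 + (C' / (2 * lam) * s ^ 2) ^ 2 := by
      field_simp
      ring
    rw [this]
    linarith [sq_nonneg (C' / (2 * lam) * s ^ 2)]
  rw [hsum]
  refine le_trans ?_ (mul_le_mul_of_nonneg_right hsq hN0)
  have g2 := mul_le_mul_of_nonneg_left F2 (by positivity : 0 ≤ 2 * s)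
  have g3 := mul_le_mul_of_nonneg_left F3 (sq_nonneg s)
  rw [hC']
  linarith

end RectangularDiagonal

section Blocks

/-- A matrix pairing nonpositively with every direction that is orthogonal to `diagRect w` and has
nonpositive quadratic form on the block where `lam ≤ σ` is symmetric on that block, vanishes
outside it, and is positive semidefinite where `σ = lam`. -/
theorem blocks_of_forall_minner_nonpos {m n : ℕ} (hmn : m ≤ n) {σ : Fin m → ℝ} {lam : ℝ}
    (A : Matrix (Fin m) (Fin n) ℝ)
    (key : ∀ Y : Matrix (Fin m) (Fin n) ℝ,
      ∑ i, max (σ i - lam) 0 * Y i (Fin.castLE hmn i) = 0 →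
      (∀ x : Fin m → ℝ, (∀ i, ¬ lam ≤ σ i → x i = 0) →
        ∑ i, ∑ j, x i * Y i (Fin.castLE hmn j) * x j ≤ 0) → minner Y A ≤ 0) :
    (∀ i j : Fin m, lam ≤ σ i → lam ≤ σ j → A i (Fin.castLE hmn j) = A j (Fin.castLE hmn i)) ∧
    (∀ x : Fin m → ℝ, (∀ i, σ i ≠ lam → x i = 0) →
      0 ≤ ∑ i, ∑ j, x i * A i (Fin.castLE hmn j) * x j) ∧
    (∀ (i : Fin m) (j : Fin n),
      ¬ (lam ≤ σ i ∧ ∃ hj : (j : ℕ) < m, lam ≤ σ ⟨(j : ℕ), hj⟩) → A i j = 0) := by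
  have hsingle : ∀ (i : Fin m) (j : Fin n) (c : ℝ), minner (Matrix.single i j c) A = c * A i j := by
    intro i j c
    rw [minner_eq_sum, Finset.sum_eq_single i, Finset.sum_eq_single j]
    · simp
    · intro l _ hl
      simp [hl.symm]
    · simp
    · intro k _ hk
      simp [hk.symm]
    · simp
  refine ⟨fun i j _ _ => ?_, fun x hx => ?_, fun i j hij => ?_⟩
  · set c := A i (Fin.castLE hmn j) - A j (Fin.castLE hmn i) with hc
    set Y : Matrix (Fin m) (Fin n) ℝ :=
      Matrix.single i (Fin.castLE hmn j) c + Matrix.single j (Fin.castLE hmn i) (-c) with hYdef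
    have hskew : ∀ k l, Y k (Fin.castLE hmn l) = -Y l (Fin.castLE hmn k) := by
      intro k l
      simp only [hYdef, Matrix.add_apply, Matrix.single_apply, (Fin.castLE_injective hmn).eq_iff]
      grind
    have h := key Y ?_ fun x _ => ?_
    · rw [hYdef, minner_add_left, hsingle, hsingle] at h
      have : c ^ 2 ≤ 0 := by rw [sq]; nth_rewrite 2 [hc]; linarith
      have : c = 0 := by nlinarith
      linarith
    · refine Finset.sum_eq_zero fun k _ => ?_
      have : Y k (Fin.castLE hmn k) = 0 := by linarith [hskew k k]
      rw [this, mul_zero]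
    · have h1 : ∑ k, ∑ l, x k * Y k (Fin.castLE hmn l) * x l =
          -∑ k, ∑ l, x k * Y k (Fin.castLE hmn l) * x l := by
        conv_rhs => rw [Finset.sum_comm]
        rw [← Finset.sum_neg_distrib]
        refine Finset.sum_congr rfl fun k _ => ?_
        rw [← Finset.sum_neg_distrib]
        refine Finset.sum_congr rfl fun l _ => ?_
        rw [hskew k l]
        ring
      linarith
  · set z : Fin n → ℝ := fun j => if h : (j : ℕ) < m then x ⟨j, h⟩ else 0 with hz
    have hzx : ∀ i, z (Fin.castLE hmn i) = x i := fun i => by simp [hz]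
    have hz0 : ∀ j : Fin n, m ≤ (j : ℕ) → z j = 0 := fun j hj => by simp [hz, hj]
    have h := key (Matrix.of fun k l => -(x k * z l)) ?_ fun y _ => ?_
    · have e : minner (Matrix.of fun k l => -(x k * z l)) A =
          -∑ i, ∑ j, x i * A i (Fin.castLE hmn j) * x j := by
        rw [minner_eq_sum, ← Finset.sum_neg_distrib]
        refine Finset.sum_congr rfl fun i _ => ?_
        rw [sum_eq_sum_castLE hmn _ (fun j hj => by simp [hz0 j hj]), ← Finset.sum_neg_distrib]
        refine Finset.sum_congr rfl fun j _ => ?_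
        simp only [Matrix.of_apply, hzx]
        ring
      linarith
    · refine Finset.sum_eq_zero fun k _ => ?_
      by_cases hk : σ k = lam
      · simp [hk]
      · simp [hx k hk]
    · have e : ∑ i, ∑ j, y i * (Matrix.of fun k l => -(x k * z l)) i (Fin.castLE hmn j) * y j =
          -(∑ i, x i * y i) ^ 2 := by
        rw [sq, Finset.sum_mul_sum, ← Finset.sum_neg_distrib]
        refine Finset.sum_congr rfl fun i _ => ?_
        rw [← Finset.sum_neg_distrib]
        refine Finset.sum_congr rfl fun j _ => ?_
        simp only [Matrix.of_apply, hzx]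
        ring
      rw [e]
      linarith [sq_nonneg (∑ i, x i * y i)]
  · have h := key (Matrix.single i j (A i j)) ?_ fun x hx => le_of_eq ?_
    · rw [hsingle] at h
      nlinarith
    · refine Finset.sum_eq_zero fun k _ => ?_
      rw [Matrix.single_apply]
      split_ifs with hk
      · obtain ⟨rfl, rfl⟩ := hk
        have : ¬ lam ≤ σ i := fun hi => hij ⟨hi, i.2, hi⟩
        rw [max_eq_right (by linarith), zero_mul]
      · rw [mul_zero]
    · refine Finset.sum_eq_zero fun k _ => Finset.sum_eq_zero fun l _ => ?_
      rw [Matrix.single_apply]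
      split_ifs with hk
      · obtain ⟨rfl, rfl⟩ := hk
        by_cases hi : lam ≤ σ i
        · have : ¬ lam ≤ σ l := fun hl => hij ⟨hi, l.2, hl⟩
          rw [hx l this, mul_zero]
        · rw [hx i hi, zero_mul, zero_mul]
      · rw [mul_zero, zero_mul]

theorem quadForm_nonpos_of_trace_zero {m : ℕ} {σ : Fin m → ℝ} {lam : ℝ}
    (hlam1 : ∑ i, max (σ i - lam) 0 = 1) (A : Matrix (Fin m) (Fin m) ℝ)
    (htr : (∑ i, if lam ≤ σ i then A i i else 0) = 0)
    (hpsd : ∀ x : Fin m → ℝ, (∀ i, σ i ≠ lam → x i = 0) → 0 ≤ ∑ i, ∑ j, x i * A i j * x j)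
    (x : Fin m → ℝ) (hx : ∀ i, σ i ≠ lam + 1 → x i = 0) :
    ∑ i, ∑ j, x i * A i j * x j ≤ 0 := by
  by_cases hex : ∃ i, σ i = lam + 1
  swap
  · have : ∀ i, x i = 0 := fun i => hx i fun h => hex ⟨i, h⟩
    simp [this]
  obtain ⟨k, hk⟩ := hex
  have hother : ∀ i, i ≠ k → σ i ≤ lam := by
    intro i hi
    have h : ∑ i ∈ Finset.univ.erase k, max (σ i - lam) 0 = 0 := by
      have := Finset.add_sum_erase Finset.univ (fun i => max (σ i - lam) 0) (Finset.mem_univ k)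
      have hk1 : max (σ k - lam) 0 = 1 := by rw [hk, add_sub_cancel_left]; norm_num
      rw [hlam1, hk1] at this
      linarith
    have h' := (Finset.sum_eq_zero_iff_of_nonneg fun i _ => le_max_right _ _).1 h i (by simp [hi])
    linarith [le_max_left (σ i - lam) 0]
  have hdiag : ∀ i, σ i = lam → 0 ≤ A i i := by
    intro i hi
    have := hpsd (Pi.single i 1) fun j hj => Pi.single_eq_of_ne (by rintro rfl; exact hj hi) _
    simpa [Pi.single_apply] using this
  have hkk : A k k ≤ 0 := by
    have h := Finset.add_sum_erase Finset.univ (fun i => if lam ≤ σ i then A i i else 0)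
      (Finset.mem_univ k)
    rw [htr] at h
    have h2 : 0 ≤ ∑ i ∈ Finset.univ.erase k, if lam ≤ σ i then A i i else 0 := by
      refine Finset.sum_nonneg fun i hi => ?_
      split_ifs with hl
      · exact hdiag i (le_antisymm (hother i (Finset.ne_of_mem_erase hi)) hl)
      · exact le_rfl
    have h3 : lam ≤ σ k := by linarith
    simp only [h3, if_true] at h
    linarith
  have hx0 : ∀ i, i ≠ k → x i = 0 := fun i hi => hx i fun h => by
    linarith [hother i hi]
  rw [Finset.sum_eq_single k (fun i _ hi => by simp [hx0 i hi]) (by simp),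
    Finset.sum_eq_single k (fun i _ hi => by simp [hx0 i hi]) (by simp)]
  nlinarith [sq_nonneg (x k)]

/-- A symmetric perturbation of a nonnegative diagonal matrix which is positive semidefinite on the
kernel stays positive semidefinite after a suitable second-order correction. -/
theorem exists_quadForm_arc_nonneg {m : ℕ} {σ : Fin m → ℝ} {lam : ℝ} (A : Matrix (Fin m) (Fin m) ℝ)
    (hsymm : ∀ i j, A i j = A j i)
    (h0 : ∀ i j, ¬ (lam ≤ σ i ∧ lam ≤ σ j) → A i j = 0)
    (hpsd : ∀ x : Fin m → ℝ, (∀ i, σ i ≠ lam → x i = 0) → 0 ≤ ∑ i, ∑ j, x i * A i j * x j)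
    (k : ℝ) :
    ∃ c : ℝ, ∀ᶠ t : ℝ in nhdsWithin (0 : ℝ) (Set.Ioi 0), ∀ x : Fin m → ℝ,
      0 ≤ ∑ i, (max (σ i - lam) 0 +
        t ^ 2 / 2 * ((if σ i = lam then c else 0) - c * k * max (σ i - lam) 0)) * x i ^ 2 +
        t * ∑ i, ∑ j, x i * A i j * x j := by
  obtain ⟨r, hr, hgap⟩ : ∃ r > 0, ∀ i, lam < σ i → r ≤ σ i - lam := by
    have : ∀ᶠ r : ℝ in nhdsWithin 0 (Set.Ioi 0), ∀ i, lam < σ i → r ≤ σ i - lam := by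
      rw [eventually_all]
      intro i
      by_cases hi : lam < σ i
      · filter_upwards [mem_nhdsWithin_of_mem_nhds (gt_mem_nhds (sub_pos.2 hi))] with r hr _
          using le_of_lt hr
      · exact Eventually.of_forall fun _ h => absurd h hi
    obtain ⟨r, h, hr⟩ := (this.and self_mem_nhdsWithin).exists
    exact ⟨r, hr, h⟩
  set K := specNorm A with hK
  have hK0 : 0 ≤ K := specNorm_nonneg A
  set c := 4 * K ^ 2 / r with hc
  have e1 : ∀ᶠ t : ℝ in nhdsWithin (0 : ℝ) (Set.Ioi 0), t ^ 2 / 2 * (c * k) < 1 / 4 := by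
    have : Continuous fun t : ℝ => t ^ 2 / 2 * (c * k) := by fun_prop
    exact tendsto_nhdsWithin_of_tendsto_nhds (this.tendsto 0)
      |>.eventually (gt_mem_nhds (by norm_num))
  have e2 : ∀ᶠ t : ℝ in nhdsWithin (0 : ℝ) (Set.Ioi 0), t * K < r / 4 := by
    have : Continuous fun t : ℝ => t * K := by fun_prop
    exact tendsto_nhdsWithin_of_tendsto_nhds (this.tendsto 0)
      |>.eventually (gt_mem_nhds (by simpa using hr))
  refine ⟨c, ?_⟩
  filter_upwards [e1, e2, self_mem_nhdsWithin] with t h1 h2 ht x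
  have ht : 0 < t := ht
  set y : Fin m → ℝ := fun i => if lam < σ i then x i else 0 with hy
  set z : Fin m → ℝ := fun i => if σ i = lam then x i else 0 with hz
  set Y := Real.sqrt (∑ i, y i ^ 2) with hY
  set Z := Real.sqrt (∑ i, z i ^ 2) with hZ
  have hY2 : Y ^ 2 = ∑ i, y i ^ 2 := Real.sq_sqrt (Finset.sum_nonneg fun i _ => sq_nonneg _)
  have hZ2 : Z ^ 2 = ∑ i, z i ^ 2 := Real.sq_sqrt (Finset.sum_nonneg fun i _ => sq_nonneg _)
  have hd : r * (3 / 4) * Y ^ 2 + t ^ 2 / 2 * c * Z ^ 2 ≤ ∑ i, (max (σ i - lam) 0 +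
      t ^ 2 / 2 * ((if σ i = lam then c else 0) - c * k * max (σ i - lam) 0)) * x i ^ 2 := by
    rw [hY2, hZ2, Finset.mul_sum, Finset.mul_sum, ← Finset.sum_add_distrib]
    refine Finset.sum_le_sum fun i _ => ?_
    rcases lt_trichotomy (σ i) lam with h | h | h
    · simp [hy, hz, h.ne, h.not_gt, max_eq_right (by linarith : σ i - lam ≤ 0)]
    · simp [hy, hz, h]
    · simp only [hy, hz, h, h.ne', if_true, if_false, max_eq_left (by linarith : 0 ≤ σ i - lam)]
      have hg := hgap i h
      have : r * (3 / 4) ≤ σ i - lam + t ^ 2 / 2 * (0 - c * k * (σ i - lam)) := by nlinarith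
      nlinarith [sq_nonneg (x i)]
  have hquad : ∑ i, ∑ j, x i * A i j * x j = ∑ i, ∑ j, y i * A i j * y j +
      2 * ∑ i, ∑ j, y i * A i j * z j + ∑ i, ∑ j, z i * A i j * z j := by
    have hsw : ∑ i, ∑ j, y i * A i j * z j = ∑ i, ∑ j, z i * A i j * y j := by
      rw [Finset.sum_comm]
      refine Finset.sum_congr rfl fun i _ => Finset.sum_congr rfl fun j _ => ?_
      rw [hsymm j i]; ring
    rw [two_mul]
    nth_rewrite 2 [hsw]
    simp only [← Finset.sum_add_distrib]
    refine Finset.sum_congr rfl fun i _ => Finset.sum_congr rfl fun j _ => ?_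
    by_cases hij : lam ≤ σ i ∧ lam ≤ σ j
    · have hx : ∀ l, lam ≤ σ l → x l = y l + z l := fun l hl => by
        rcases hl.eq_or_lt with h | h
        · simp [hy, hz, ← h]
        · simp [hy, hz, h, h.ne']
      rw [hx i hij.1, hx j hij.2]; ring
    · simp [h0 i j hij]
  have hyy := (abs_le.1 (sum_bilin_le_specNorm A y y)).1
  have hyz := (abs_le.1 (sum_bilin_le_specNorm A y z)).1
  have hzz := hpsd z fun i hi => by simp [hz, hi]
  rw [hquad]
  have g1 := mul_le_mul_of_nonneg_left hyy ht.le
  have g2 := mul_le_mul_of_nonneg_left hyz ht.le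
  have g3 := mul_nonneg ht.le hzz
  have g4 : t * K * Y ^ 2 ≤ r / 4 * Y ^ 2 := mul_le_mul_of_nonneg_right h2.le (sq_nonneg _)
  have g5 : 0 ≤ r / 2 * Y ^ 2 - 2 * t * K * (Y * Z) + t ^ 2 / 2 * c * Z ^ 2 := by
    have : r / 2 * Y ^ 2 - 2 * t * K * (Y * Z) + t ^ 2 / 2 * c * Z ^ 2 =
        r / 2 * (Y - 2 * t * K / r * Z) ^ 2 := by
      rw [hc]; field_simp; ring
    rw [this]; positivity
  linarith

end Blocks

/-- formula (3.14) in the paper: joint characterization of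
`H ∈ C_{θ*}(W,P)` together with the vanishing of the sigma term `φ*_{(W,H)}(P) = 0`. -/
theorem critThetaStar_and_sigma_zero_iff {m n : ℕ} (hmn : m ≤ n)
    (P W : Matrix (Fin m) (Fin n) ℝ) (hP : P ≠ 0)
    (hW : W ∈ subdiff specNorm P)
    (U : Matrix (Fin m) (Fin m) ℝ) (V : Matrix (Fin n) (Fin n) ℝ) (σ : Fin m → ℝ)
    (hU : Uᵀ * U = 1) (hV : Vᵀ * V = 1)
    (hσa : Antitone σ) (hσ0 : ∀ i, 0 ≤ σ i)
    (hSVD : P + W = U * (diagRect σ : Matrix (Fin m) (Fin n) ℝ) * Vᵀ)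
    (lam : ℝ) (hlam0 : 0 < lam) (hlamP : lam = specNorm P)
    (hlam1 : ∑ i, max (σ i - lam) 0 = 1)
    (hPdec : P = U * (diagRect (fun i => min (σ i) lam) : Matrix (Fin m) (Fin n) ℝ) * Vᵀ)
    (hWdec : W = U * (diagRect (fun i => max (σ i - lam) 0) : Matrix (Fin m) (Fin n) ℝ) * Vᵀ)
    (H : Matrix (Fin m) (Fin n) ℝ) :
    (H ∈ critThetaStar W P ∧ sigmaThetaStar W H P = 0) ↔
      -- H̃_{αα} is symmetric
      ((∀ i j : Fin m, lam ≤ σ i → lam ≤ σ j →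
        (Uᵀ * H * V) i (Fin.castLE hmn j) = (Uᵀ * H * V) j (Fin.castLE hmn i)) ∧
      -- trace(H̃_{αα}) = 0
      (∑ i, if lam ≤ σ i then (Uᵀ * H * V) i (Fin.castLE hmn i) else 0) = 0 ∧
      -- H̃_{α₁α₁} negative semidefinite
      (∀ x : Fin m → ℝ, (∀ i, σ i ≠ lam + 1 → x i = 0) →
        (∑ i, ∑ j, x i * (Uᵀ * H * V) i (Fin.castLE hmn j) * x j) ≤ 0) ∧
      -- H̃_{α₃α₃} positive semidefinite
      (∀ x : Fin m → ℝ, (∀ i, σ i ≠ lam → x i = 0) →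
        0 ≤ ∑ i, ∑ j, x i * (Uᵀ * H * V) i (Fin.castLE hmn j) * x j) ∧
      -- all blocks of H̃ outside the αα block vanish
      (∀ (i : Fin m) (j : Fin n),
        ¬ (lam ≤ σ i ∧ ∃ hj : (j : ℕ) < m, lam ≤ σ ⟨(j : ℕ), hj⟩) →
        (Uᵀ * H * V) i j = 0)) := by
  have hU' : U * Uᵀ = 1 := mul_eq_one_comm.1 hU
  have hV' : V * Vᵀ = 1 := mul_eq_one_comm.1 hV
  set A := Uᵀ * H * V with hA
  have hHA : H = U * A * Vᵀ := by
    calc H = (U * Uᵀ) * H * (V * Vᵀ) := by rw [hU', hV']; simp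
      _ = _ := by rw [hA]; simp only [Matrix.mul_assoc]
  have hback : ∀ Y : Matrix (Fin m) (Fin n) ℝ, Uᵀ * (U * Y * Vᵀ) * V = Y := fun Y => by
    calc Uᵀ * (U * Y * Vᵀ) * V = (Uᵀ * U) * Y * (Vᵀ * V) := by simp only [Matrix.mul_assoc]
      _ = Y := by rw [hU, hV]; simp
  have hconj : ∀ X Y : Matrix (Fin m) (Fin n) ℝ,
      minner (U * X * Vᵀ) (U * Y * Vᵀ) = minner X Y := fun X Y => by
    rw [minner_conj, hback]
  have hp0 : ∀ i, 0 ≤ min (σ i) lam := fun i => le_min (hσ0 i) hlam0.le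
  have hple : ∀ i, min (σ i) lam ≤ lam := fun i => min_le_right _ _
  have hpα : ∀ i, min (σ i) lam = lam ↔ lam ≤ σ i := fun i => min_eq_right_iff
  have hwp : ∀ i, max (σ i - lam) 0 * min (σ i) lam = lam * max (σ i - lam) 0 := fun i => by
    rcases le_total lam (σ i) with h | h
    · rw [min_eq_right h, mul_comm]
    · simp [max_eq_right (by linarith : σ i - lam ≤ 0)]
  have hWball : W ∈ nuclearBall (Fin m) (Fin n) := by
    rw [hWdec]
    exact conj_mem_nuclearBall hU' hV
      (diagRect_mem_nuclearBall hmn (fun i => le_max_right _ _) hlam1)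
  have hWP : minner W P = specNorm P := by
    rw [← hlamP, hPdec, hWdec, hconj, minner_diagRect hmn]
    simp only [diagRect_castLE, if_true, hwp]
    rw [← Finset.mul_sum, hlam1, mul_one]
  have hHP : minner H P = ∑ i, min (σ i) lam * A i (Fin.castLE hmn i) := by
    rw [hHA, hPdec, hconj, minner_comm, minner_diagRect hmn]
  have hdiagP : (∀ (i : Fin m) (j : Fin n),
      ¬ (lam ≤ σ i ∧ ∃ hj : (j : ℕ) < m, lam ≤ σ ⟨(j : ℕ), hj⟩) → A i j = 0) →
      minner H P = lam * ∑ i, if lam ≤ σ i then A i (Fin.castLE hmn i) else 0 := by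
    intro h
    rw [hHP, Finset.mul_sum]
    refine Finset.sum_congr rfl fun i _ => ?_
    split_ifs with hi
    · rw [(hpα i).2 hi]
    · rw [h i _ fun h' => hi h'.1, mul_zero, mul_zero]
  constructor
  · rintro ⟨hcrit, hsig⟩
    obtain ⟨-, hHP0⟩ := epiDeriv_eq_zero_of_mem_critThetaStar hWball hcrit
    obtain ⟨hsymm, hpsd, hzero⟩ := blocks_of_forall_minner_nonpos (σ := σ) (lam := lam) hmn A <| by
      intro Y hwY hquad
      obtain ⟨C, hC⟩ := exists_specNorm_diagRect_add_le hmn hlam0 hp0 hple Y fun x hx =>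
        hquad x fun i hi => hx i fun h => hi ((hpα i).1 h)
      have h := minner_nonpos_of_sigma_zero hWball hWP hcrit hsig (Y := U * Y * Vᵀ) (C := C) ?_ ?_
      · rwa [hHA, hconj, minner_comm] at h
      · rw [hWdec, hconj, minner_diagRect hmn, hwY]
      · intro s hs
        rw [← hlamP]
        refine le_trans ?_ (hC s hs)
        refine le_trans (le_of_eq ?_) (specNorm_conj_le hU hV' _)
        conv_lhs => rw [hPdec]
        simp [Matrix.mul_add, Matrix.add_mul]
    have htr : (∑ i, if lam ≤ σ i then A i (Fin.castLE hmn i) else 0) = 0 := by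
      have := hdiagP hzero
      rw [hHP0] at this
      exact (mul_eq_zero.1 this.symm).resolve_left hlam0.ne'
    exact ⟨hsymm, htr, quadForm_nonpos_of_trace_zero hlam1
      (A.submatrix id (Fin.castLE hmn)) htr hpsd, hpsd, hzero⟩
  · rintro ⟨hsymm, htr, -, hpsd, hzero⟩
    have hzero' : ∀ i j : Fin m, ¬ (lam ≤ σ i ∧ lam ≤ σ j) → A i (Fin.castLE hmn j) = 0 :=
      fun i j hij => hzero i _ fun h => hij ⟨h.1, h.2.2⟩
    have hsymm' : ∀ i j : Fin m, A i (Fin.castLE hmn j) = A j (Fin.castLE hmn i) := fun i j => by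
      by_cases hij : lam ≤ σ i ∧ lam ≤ σ j
      · exact hsymm i j hij.1 hij.2
      · rw [hzero' i j hij, hzero' j i fun h => hij h.symm]
    set k : ℝ := ∑ i, if σ i = lam then 1 else 0 with hk
    obtain ⟨c, hc⟩ := exists_quadForm_arc_nonneg (A.submatrix id (Fin.castLE hmn)) hsymm' hzero'
      hpsd k
    set d : Fin m → ℝ := fun i => (if σ i = lam then c else 0) - c * k * max (σ i - lam) 0 with hd
    have hdsum : ∑ i, d i = 0 := by
      simp only [hd, Finset.sum_sub_distrib]
      rw [← Finset.mul_sum, hlam1, hk, Finset.mul_sum, Finset.sum_mul]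
      simp
    set Z : Matrix (Fin m) (Fin n) ℝ := U * (diagRect d : Matrix (Fin m) (Fin n) ℝ) * Vᵀ with hZ
    refine crit_and_sigma_zero_of_arc (Z := Z) hWball hWP ?_ ?_ ?_
    · rw [hdiagP hzero, htr, mul_zero]
    · rw [hPdec, hZ, hconj, minner_diagRect hmn]
      have : ∀ i, d i * min (σ i) lam = lam * d i := fun i => by
        simp only [hd, sub_mul, mul_sub, mul_assoc, hwp]
        split_ifs with hi
        · simp only [hi, min_self]; ring
        · ring
      simp only [diagRect_castLE, if_true, this]
      rw [← Finset.mul_sum, hdsum, mul_zero]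
    · filter_upwards [hc] with t hct
      have hX : W + t • H + (t ^ 2 / 2) • Z =
          U * ((diagRect (fun i => max (σ i - lam) 0) : Matrix (Fin m) (Fin n) ℝ) + t • A +
            (t ^ 2 / 2) • (diagRect d : Matrix (Fin m) (Fin n) ℝ)) * Vᵀ := by
        rw [hWdec, hHA, hZ]
        simp [Matrix.mul_add, Matrix.add_mul]
      rw [hX]
      refine conj_mem_nuclearBall hU' hV (mem_nuclearBall_of_posSemidef hmn ?_ ?_ ?_)
      · refine Matrix.PosSemidef.of_dotProduct_mulVec_nonneg ?_ fun x => ?_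
        · ext i j
          simp only [Matrix.conjTranspose_apply, Matrix.submatrix_apply, Matrix.add_apply,
            Matrix.smul_apply, diagRect_castLE, id, star_trivial, hsymm' j i]
          by_cases hij : i = j
          · subst hij; rfl
          · simp [hij, Ne.symm hij]
        · refine (hct x).trans_eq ?_
          simp only [dotProduct, Matrix.mulVec, Matrix.submatrix_apply, id, Finset.mul_sum,
            Matrix.add_apply, Matrix.smul_apply, diagRect_castLE, Pi.star_apply, star_trivial,
            smul_eq_mul, ← Finset.sum_add_distrib]
          refine Finset.sum_congr rfl fun i _ => ?_
          have : ∀ j, x i * (((if i = j then max (σ i - lam) 0 else 0) + t * A i (Fin.castLE hmn j)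
              + t ^ 2 / 2 * if i = j then d i else 0) * x j) =
              (if i = j then (max (σ i - lam) 0 + t ^ 2 / 2 * d i) * x i ^ 2 else 0) +
              t * (x i * A i (Fin.castLE hmn j) * x j) := fun j => by
            split_ifs with hij
            · subst hij; ring
            · ring
          simp only [this, Finset.sum_add_distrib]
          simp [hd]
      · have htr' : ∑ i, A i (Fin.castLE hmn i) = 0 := by
          rw [← htr]
          refine Finset.sum_congr rfl fun i _ => ?_
          split_ifs with hi
          · rfl
          · exact hzero' i i fun h => hi h.1
        simp only [Matrix.add_apply, Matrix.smul_apply, diagRect_castLE, if_true, smul_eq_mul,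
          Finset.sum_add_distrib, ← Finset.mul_sum, hdsum, htr', hlam1]
        ring
      · intro i j hj
        have := hzero i j fun h => absurd h.2.1 (not_lt.2 hj)
        simp [diagRect_of_le _ i j hj, this]
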